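/- Let k be a field and n, p natural numbers. Then there exist natural numbers l_1, …, l_{n²} and m_1, …, m_{n²} and a map φ from (k^{n×n})^p to the product ∏_{j=1}^{n²} k^{l_j×m_j}, each of whose coordinate functions is a polynomial in the entries of the input tuple, such that for all tuples A, B ∈ (k^{n×n})^p: A and B are simultaneously similar if and only if for every j ∈ [n²] there exists an invertible matrix S_j ∈ GL_{l_j}(k) with φ(B)_j = S_j · φ(A)_j. Equivalently, the preimage under φ of an orbit of the group ∏_j GL_{l_j}(k) acting by componentwise left multiplication is empty or a single GL_n(k)-orbit for simultaneous similarity. -/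

import Mathlib

open Matrix

open scoped Kronecker

section LinearAlgebra

variable {k : Type*} [Field k]

/-- Over a field, every matrix has a one-sided inverse modulo a projection onto its kernel. -/
theorem exists_mul_add_eq_one {m n : Type*} [Fintype m] [Fintype n] [DecidableEq m]
    [DecidableEq n] (L : Matrix m n k) :
    ∃ (U : Matrix n m k) (D : Matrix n n k), U * L + D = 1 ∧ L * D = 0 := by
  obtain ⟨s, hs⟩ := (toLin' L).rangeRestrict.exists_rightInverse_of_surjective
    (LinearMap.range_rangeRestrict _)
  obtain ⟨g, hg⟩ := s.exists_extend
  have key : toLin' L ∘ₗ g ∘ₗ toLin' L = toLin' L := by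
    ext1 x
    have h1 := LinearMap.congr_fun hg ((toLin' L).rangeRestrict (Pi.single x 1))
    have h2 := LinearMap.congr_fun hs ((toLin' L).rangeRestrict (Pi.single x 1))
    have h3 := congrArg Subtype.val h2
    apply LinearMap.ext_ring
    simp only [LinearMap.comp_apply, LinearMap.coe_single, Submodule.subtype_apply,
      LinearMap.id_apply] at h1 h3 ⊢
    have h4 : ((toLin' L).rangeRestrict (Pi.single x 1) : m → k) = toLin' L (Pi.single x 1) := rfl
    rw [← h4, h1, ← h3]
    rfl
  have hL : L * LinearMap.toMatrix' g * L = L := by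
    have := congrArg LinearMap.toMatrix' key
    rwa [LinearMap.toMatrix'_comp, LinearMap.toMatrix'_comp, LinearMap.toMatrix'_toLin',
      ← Matrix.mul_assoc] at this
  refine ⟨LinearMap.toMatrix' g, 1 - LinearMap.toMatrix' g * L, by simp, ?_⟩
  rw [Matrix.mul_sub, Matrix.mul_one, ← Matrix.mul_assoc, hL, sub_self]

/-- Matrices of the same size with the same kernel differ by an invertible left factor. -/
theorem exists_GL_mul_eq_of_ker_eq {l m : Type*} [Fintype l] [Fintype m] [DecidableEq l]
    [DecidableEq m] {P Q : Matrix l m k} (h : ∀ c, P *ᵥ c = 0 ↔ Q *ᵥ c = 0) :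
    ∃ S : GL l k, Q = S.val * P := by
  have hker : LinearMap.ker (toLin' P) = LinearMap.ker (toLin' Q) := by
    ext c
    simpa using h c
  obtain ⟨e, he⟩ := Submodule.exists_linearEquiv_restrict_eq
    ((toLin' P).quotKerEquivRange.symm ≪≫ₗ Submodule.quotEquivOfEq _ _ hker ≪≫ₗ
      (toLin' Q).quotKerEquivRange)
  refine ⟨⟨LinearMap.toMatrix' e.toLinearMap, LinearMap.toMatrix' e.symm.toLinearMap, ?_, ?_⟩, ?_⟩
  · rw [← LinearMap.toMatrix'_comp]
    simp
  · rw [← LinearMap.toMatrix'_comp]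
    simp
  · apply toLin'.injective
    rw [toLin'_mul, toLin'_toMatrix']
    refine LinearMap.ext fun c => ?_
    have := he ⟨toLin' P c, LinearMap.mem_range_self _ c⟩
    have h2 : (toLin' P).quotKerEquivRange.symm ⟨toLin' P c, LinearMap.mem_range_self _ c⟩ =
        Submodule.Quotient.mk c := by
      rw [LinearEquiv.symm_apply_eq]
      rfl
    simp only [LinearEquiv.trans_apply, h2] at this
    exact this

/-- A finite-dimensional space of functions is detected by finitely many points. -/
theorem exists_detecting_points {α ι : Type*} [Fintype ι] (u : α → ι → k) :
    ∃ (m : ℕ) (x : Fin m → α), ∀ w : ι → k,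
      (∀ i, u (x i) ⬝ᵥ w = 0) → ∀ a, u a ⬝ᵥ w = 0 := by
  obtain ⟨t, ht, hspan⟩ := (Submodule.fg_span_iff_fg_span_finset_subset (R := k) (Set.range u)).1
    (IsNoetherian.noetherian _)
  choose g hg using fun v : t => ht v.2
  refine ⟨t.card, fun i => g (t.equivFin.symm i), fun w hw a => ?_⟩
  have hle : Submodule.span k (Set.range u) ≤ LinearMap.ker (dotProductBilin k k |>.flip w) := by
    rw [hspan, Submodule.span_le]
    intro v hv
    have := hw (t.equivFin ⟨v, hv⟩)
    simp only [Equiv.symm_apply_apply, hg] at this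
    simpa using this
  simpa using hle (Submodule.subset_span ⟨a, rfl⟩)

/-- A kernel that is separable in each of its last two variables can be sampled at finitely many
points so that the left equivalence class of the sample matrix determines its zero locus. -/
theorem exists_sample_matrix {α β γ ι κ : Type*} [Fintype ι] [Fintype κ] (F : α → β → γ → k)
    (u : β → ι → k) (u' : α → γ → ι → k) (hu : ∀ a x z, F a x z = u x ⬝ᵥ u' a z)
    (w : γ → κ → k) (w' : α → β → κ → k) (hw : ∀ a x z, F a x z = w z ⬝ᵥ w' a x) :
    ∃ (l m : ℕ) (x : Fin m → β) (z : Fin l → γ),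
      (∀ a b, (∀ z, ∃ z', ∀ x, F b x z = F a x z') → (∀ z, ∃ z', ∀ x, F a x z = F b x z') →
        ∃ S : GL (Fin l) k, (of fun i j => F b (x j) (z i)) =
          S.val * of fun i j => F a (x j) (z i)) ∧
      (∀ a b, (∃ S : GL (Fin l) k, (of fun i j => F b (x j) (z i)) =
          S.val * of fun i j => F a (x j) (z i)) →
        ∀ x, (∃ z, F b x z ≠ 0) → ∃ z, F a x z ≠ 0) := by
  obtain ⟨m, x, hx⟩ := exists_detecting_points u
  obtain ⟨l, z, hz⟩ := exists_detecting_points w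
  refine ⟨l, m, x, z, fun a b h1 h2 => exists_GL_mul_eq_of_ker_eq fun c => ?_, ?_⟩
  · have key : ∀ a b, (∀ z, ∃ z', ∀ x, F b x z = F a x z') →
        (of fun i j => F a (x j) (z i)) *ᵥ c = 0 → (of fun i j => F b (x j) (z i)) *ᵥ c = 0 := by
      intro a b h h0
      have h3 : ∀ z, w z ⬝ᵥ (∑ j, c j • w' a (x j)) = 0 := by
        refine hz _ fun i => ?_
        have := congrFun h0 i
        simp only [dotProduct_sum, dotProduct_smul, ← hw]
        simpa [mulVec, dotProduct, mul_comm] using this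
      ext i
      obtain ⟨z', hz'⟩ := h (z i)
      have := h3 z'
      simp only [dotProduct_sum, dotProduct_smul, ← hw, ← hz'] at this
      simpa [mulVec, dotProduct, mul_comm] using this
    exact ⟨key a b h1, key b a h2⟩
  · rintro a b ⟨S, hS⟩ y ⟨z₀, hy⟩
    by_contra! h0
    refine hy ?_
    rw [hw]
    refine hz _ (fun i => ?_) z₀
    rw [← hw]
    have h3 : ∀ y, u y ⬝ᵥ (u' b (z i) - ∑ i', S.val i i' • u' a (z i')) = 0 := by
      refine hx _ fun j => ?_
      have := congrFun (congrFun hS i) j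
      simp only [of_apply, Matrix.mul_apply] at this
      simp [dotProduct_sub, dotProduct_sum, ← hu, this]
    have := h3 y
    simpa [dotProduct_sub, dotProduct_sum, ← hu, h0] using this

/-- A polynomial in two groups of variables separates them. -/
theorem MvPolynomial.eval_sumElim_eq_dotProduct {σ τ : Type*} [Fintype σ] [Fintype τ]
    (q : MvPolynomial (σ ⊕ τ) k) (x : σ → k) (y : τ → k) :
    MvPolynomial.eval (Sum.elim x y) q =
      (fun d : q.support => ∏ i, x i ^ d.1 (Sum.inl i)) ⬝ᵥ
        fun d : q.support => q.coeff d.1 * ∏ i, y i ^ d.1 (Sum.inr i) := by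
  rw [MvPolynomial.eval_eq', ← Finset.sum_coe_sort]
  refine Finset.sum_congr rfl fun d _ => ?_
  simp only [Fintype.prod_sum_type, Sum.elim_inl, Sum.elim_inr]
  ring

end LinearAlgebra

section Sylvester

variable {n p : ℕ} {R : Type*} [CommRing R]

/-- The matrix of `Y ↦ A * Y - Y * X`. -/
def sylvester (A X : Matrix (Fin n) (Fin n) R) : Matrix (Fin n × Fin n) (Fin n × Fin n) R :=
  1 ⊗ₖ A - Xᵀ ⊗ₖ 1

theorem sylvester_mulVec_vec (A X Y : Matrix (Fin n) (Fin n) R) :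
    sylvester A X *ᵥ vec Y = vec (A * Y - Y * X) := by
  simp [sylvester, sub_mulVec, kronecker_mulVec_vec]

theorem sylvester_mul_one_kronecker {A B X S : Matrix (Fin n) (Fin n) R} (h : B * S = S * A) :
    sylvester B X * (1 ⊗ₖ S) = (1 ⊗ₖ S) * sylvester A X := by
  simp [sylvester, Matrix.sub_mul, Matrix.mul_sub, ← mul_kronecker_mul, h]

/-- A generic square system supported on the row span of the Sylvester matrices and `D * C`. -/
def pencil (A X : Fin p → Matrix (Fin n) (Fin n) R) (D : Matrix (Fin n × Fin n) (Fin n × Fin n) R)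
    (U : Fin p → Matrix (Fin n × Fin n) (Fin n × Fin n) R)
    (C : Matrix (Fin n × Fin n) (Fin n × Fin n) R) : Matrix (Fin n × Fin n) (Fin n × Fin n) R :=
  ∑ i, U i * sylvester (A i) (X i) + D * C

/-- The solution of the system `pencil A X D U C *ᵥ y = D *ᵥ e`, up to a determinant,
as a square matrix. -/
def cramerSolution (A X : Fin p → Matrix (Fin n) (Fin n) R)
    (D : Matrix (Fin n × Fin n) (Fin n × Fin n) R)
    (U : Fin p → Matrix (Fin n × Fin n) (Fin n × Fin n) R)
    (C : Matrix (Fin n × Fin n) (Fin n × Fin n) R) (e : Fin n × Fin n → R) :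
    Matrix (Fin n) (Fin n) R :=
  of fun i j => ((pencil A X D U C).adjugate *ᵥ (D *ᵥ e)) (j, i)

theorem vec_cramerSolution (A X : Fin p → Matrix (Fin n) (Fin n) R)
    (D : Matrix (Fin n × Fin n) (Fin n × Fin n) R)
    (U : Fin p → Matrix (Fin n × Fin n) (Fin n × Fin n) R)
    (C : Matrix (Fin n × Fin n) (Fin n × Fin n) R) (e : Fin n × Fin n → R) :
    vec (cramerSolution A X D U C e) = (pencil A X D U C).adjugate *ᵥ (D *ᵥ e) :=
  rfl

theorem pencil_mul_one_kronecker {A B X : Fin p → Matrix (Fin n) (Fin n) R}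
    {S : Matrix (Fin n) (Fin n) R} (h : ∀ i, B i * S = S * A i)
    (D : Matrix (Fin n × Fin n) (Fin n × Fin n) R)
    (U : Fin p → Matrix (Fin n × Fin n) (Fin n × Fin n) R)
    (C : Matrix (Fin n × Fin n) (Fin n × Fin n) R) :
    pencil B X D U C * (1 ⊗ₖ S) = pencil A X D (fun i => U i * (1 ⊗ₖ S)) (C * (1 ⊗ₖ S)) := by
  simp [pencil, Matrix.add_mul, Matrix.sum_mul, Matrix.mul_assoc, sylvester_mul_one_kronecker (h _)]

/-- The polynomial invariant: depending on the switches `t`, it tests the corank of the Sylvester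
system or the existence of an invertible solution. -/
def testFun (A X : Fin p → Matrix (Fin n) (Fin n) R)
    (D : Matrix (Fin n × Fin n) (Fin n × Fin n) R) (t : Fin 2 → R)
    (U : Fin p → Matrix (Fin n × Fin n) (Fin n × Fin n) R)
    (C : Matrix (Fin n × Fin n) (Fin n × Fin n) R) (e : Fin n × Fin n → R) (z : Fin 2 → R) : R :=
  (pencil A X D U C).det * (t 0 * z 0 + t 1 * z 1 * (cramerSolution A X D U C e).det)

theorem sylvester_map {R' : Type*} [CommRing R'] (f : R →+* R') (A X : Matrix (Fin n) (Fin n) R) :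
    (sylvester A X).map f = sylvester (A.map f) (X.map f) := by
  ext i j
  simp [sylvester, kroneckerMap_apply, Matrix.one_apply, apply_ite f]

theorem pencil_map {R' : Type*} [CommRing R'] (f : R →+* R')
    (A X : Fin p → Matrix (Fin n) (Fin n) R) (D : Matrix (Fin n × Fin n) (Fin n × Fin n) R)
    (U : Fin p → Matrix (Fin n × Fin n) (Fin n × Fin n) R)
    (C : Matrix (Fin n × Fin n) (Fin n × Fin n) R) :
    (pencil A X D U C).map f = pencil (fun i => (A i).map f) (fun i => (X i).map f) (D.map f)
      (fun i => (U i).map f) (C.map f) := by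
  simp only [← RingHom.mapMatrix_apply, pencil, map_add, map_sum, map_mul]
  simp only [RingHom.mapMatrix_apply, sylvester_map]

theorem testFun_map {R' : Type*} [CommRing R'] (f : R →+* R')
    (A X : Fin p → Matrix (Fin n) (Fin n) R) (D : Matrix (Fin n × Fin n) (Fin n × Fin n) R)
    (t : Fin 2 → R) (U : Fin p → Matrix (Fin n × Fin n) (Fin n × Fin n) R)
    (C : Matrix (Fin n × Fin n) (Fin n × Fin n) R) (e : Fin n × Fin n → R) (z : Fin 2 → R) :
    f (testFun A X D t U C e z) = testFun (fun i => (A i).map f) (fun i => (X i).map f) (D.map f)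
      (f ∘ t) (fun i => (U i).map f) (C.map f) (f ∘ e) (f ∘ z) := by
  have h : (cramerSolution A X D U C e).map f = cramerSolution (fun i => (A i).map f)
      (fun i => (X i).map f) (D.map f) (fun i => (U i).map f) (C.map f) (f ∘ e) := by
    ext i j
    simp only [cramerSolution, map_apply, of_apply, RingHom.map_mulVec, ← pencil_map]
    rw [← RingHom.mapMatrix_apply f (pencil A X D U C), ← RingHom.map_adjugate]
    congr 2
    ext v
    simp [RingHom.map_mulVec]
  simp only [testFun, map_mul, map_add, RingHom.map_det, RingHom.mapMatrix_apply, h, pencil_map,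
    Function.comp_apply]

theorem exists_testFun_eq {A B : Fin p → Matrix (Fin n) (Fin n) R} (S : GL (Fin n) R)
    (h : ∀ i, B i * S.val = S.val * A i) (U : Fin p → Matrix (Fin n × Fin n) (Fin n × Fin n) R)
    (C : Matrix (Fin n × Fin n) (Fin n × Fin n) R) (e : Fin n × Fin n → R) (z : Fin 2 → R) :
    ∃ U' C' z', ∀ X D t, testFun B X D t U C e z = testFun A X D t U' C' e z' := by
  have hG : ((1 : Matrix (Fin n) (Fin n) R) ⊗ₖ S.val) * (1 ⊗ₖ S⁻¹.val) = 1 := by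
    rw [← mul_kronecker_mul]
    simp
  have hG' : ((1 : Matrix (Fin n) (Fin n) R) ⊗ₖ S⁻¹.val) * (1 ⊗ₖ S.val) = 1 := by
    rw [← mul_kronecker_mul]
    simp
  set G : Matrix (Fin n × Fin n) (Fin n × Fin n) R := 1 ⊗ₖ S.val with hGdef
  set G' : Matrix (Fin n × Fin n) (Fin n × Fin n) R := 1 ⊗ₖ S⁻¹.val
  have hadj : G'.adjugate = G'.det • G := by
    calc G'.adjugate = G'.adjugate * (G' * G) := by rw [hG', Matrix.mul_one]
      _ = G'.det • G := by rw [← Matrix.mul_assoc, adjugate_mul, smul_mul, Matrix.one_mul]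
  refine ⟨fun i => U i * G, C * G,
    ![G'.det * z 0, G'.det * (G'.det ^ n * S.val.det) * z 1], fun X D t => ?_⟩
  have hp : pencil B X D U C = pencil A X D (fun i => U i * G) (C * G) * G' := by
    rw [← pencil_mul_one_kronecker h, Matrix.mul_assoc, hG, Matrix.mul_one]
  have hc : cramerSolution B X D U C e =
      G'.det • (S.val * cramerSolution A X D (fun i => U i * G) (C * G) e) := by
    rw [← vec_inj, vec_cramerSolution, hp, adjugate_mul_distrib, hadj, vec_smul,
      vec_mul_eq_mulVec, vec_cramerSolution, smul_mul, smul_mulVec, mulVec_mulVec, mulVec_mulVec,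
      mulVec_mulVec, ← hGdef, Matrix.mul_assoc]
  simp only [testFun, hc, hp, det_mul, det_smul, Fintype.card_fin, cons_val_zero, cons_val_one]
  ring

end Sylvester

section Similarity

variable {k : Type*} [Field k] {n p : ℕ}

/-- The space of `Y` with `A i * Y = Y * X i` for all `i`, in vectorized form. -/
def homSpace (A X : Fin p → Matrix (Fin n) (Fin n) k) : Submodule k (Fin n × Fin n → k) :=
  ⨅ i, LinearMap.ker (toLin' (sylvester (A i) (X i)))

theorem mem_homSpace {A X : Fin p → Matrix (Fin n) (Fin n) k} {y : Fin n × Fin n → k} :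
    y ∈ homSpace A X ↔ ∀ i, sylvester (A i) (X i) *ᵥ y = 0 := by
  simp [homSpace]

theorem vec_mem_homSpace {A X : Fin p → Matrix (Fin n) (Fin n) k} {Y : Matrix (Fin n) (Fin n) k} :
    vec Y ∈ homSpace A X ↔ ∀ i, A i * Y = Y * X i := by
  simp only [mem_homSpace, sylvester_mulVec_vec, vec_eq_zero_iff, sub_eq_zero]

theorem exists_pencil_eq_one (A X : Fin p → Matrix (Fin n) (Fin n) k) :
    ∃ U D, pencil A X D U 1 = 1 ∧ LinearMap.range (toLin' D) = homSpace A X := by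
  obtain ⟨U, D, h1, h2⟩ := exists_mul_add_eq_one
    (of fun (u : Fin p × Fin n × Fin n) v => sylvester (A u.1) (X u.1) u.2 v)
  have hM : pencil A X D (fun i => of fun a b => U a (i, b)) 1 = 1 := by
    refine Eq.trans ?_ h1
    rw [pencil, Matrix.mul_one]
    congr 1
    ext a b
    simp [Matrix.sum_apply, Matrix.mul_apply, Fintype.sum_prod_type]
  refine ⟨fun i => of fun a b => U a (i, b), D, hM, le_antisymm ?_ fun y hy => ⟨y, ?_⟩⟩
  · rintro _ ⟨y, rfl⟩
    rw [mem_homSpace]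
    intro i
    have h3 : sylvester (A i) (X i) * D = 0 := by
      ext a b
      have := congrFun (congrFun h2 (i, a)) b
      simpa [Matrix.mul_apply] using this
    rw [toLin'_apply, mulVec_mulVec, h3, zero_mulVec]
  · rw [mem_homSpace] at hy
    have := congrArg (· *ᵥ y) hM
    simpa [pencil, add_mulVec, sum_mulVec, ← mulVec_mulVec, hy] using this

theorem map_pencil_homSpace_le (A X : Fin p → Matrix (Fin n) (Fin n) k)
    (D : Matrix (Fin n × Fin n) (Fin n × Fin n) k)
    (U : Fin p → Matrix (Fin n × Fin n) (Fin n × Fin n) k)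
    (C : Matrix (Fin n × Fin n) (Fin n × Fin n) k) :
    (homSpace A X).map (toLin' (pencil A X D U C)) ≤ LinearMap.range (toLin' D) := by
  rintro _ ⟨y, hy, rfl⟩
  rw [SetLike.mem_coe, mem_homSpace] at hy
  exact ⟨C *ᵥ y, by simp [pencil, hy]⟩

theorem finrank_homSpace_le {A B X : Fin p → Matrix (Fin n) (Fin n) k}
    (h : ∀ D t, (∃ U C e z, testFun A X D t U C e z ≠ 0) →
      ∃ U C e z, testFun B X D t U C e z ≠ 0) :
    Module.finrank k (homSpace B X) ≤ Module.finrank k (homSpace A X) := by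
  obtain ⟨U, D, hM, hD⟩ := exists_pencil_eq_one A X
  obtain ⟨U', C, e, z, hz⟩ := h D ![1, 0] ⟨U, 1, 0, 1, by simp [testFun, hM]⟩
  have hinj : Function.Injective (toLin' (pencil B X D U' C)) :=
    mulVec_injective_of_det_ne_zero (left_ne_zero_of_mul hz)
  rw [(Submodule.equivMapOfInjective _ hinj (homSpace B X)).finrank_eq, ← hD]
  exact Submodule.finrank_mono (map_pencil_homSpace_le B X D U' C)

theorem exists_conj_of_testFun {A B : Fin p → Matrix (Fin n) (Fin n) k}
    (h : ∀ X D t, (∃ U C e z, testFun A X D t U C e z ≠ 0) ↔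
      ∃ U C e z, testFun B X D t U C e z ≠ 0) :
    ∃ S : GL (Fin n) k, ∀ i, B i = S.val * A i * S⁻¹.val := by
  have hr : Module.finrank k (homSpace B A) = Module.finrank k (homSpace A A) :=
    le_antisymm (finrank_homSpace_le fun D t => (h A D t).1)
      (finrank_homSpace_le fun D t => (h A D t).2)
  obtain ⟨U, D, hM, hD⟩ := exists_pencil_eq_one A A
  have h1 : vec (1 : Matrix (Fin n) (Fin n) k) ∈ LinearMap.range (toLin' D) := by
    rw [hD, vec_mem_homSpace]
    simp
  obtain ⟨e, he⟩ := h1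
  have hc : cramerSolution A A D U 1 e = 1 := by
    rw [← vec_inj, vec_cramerSolution, hM, adjugate_one, one_mulVec, ← he, toLin'_apply]
  obtain ⟨U', C, e', z, hz⟩ := (h A D ![0, 1]).1 ⟨U, 1, e, 1, by simp [testFun, hM, hc]⟩
  simp only [testFun, cons_val_zero, cons_val_one, zero_mul, zero_add] at hz
  have hdet := left_ne_zero_of_mul hz
  set Y := cramerSolution B A D U' C e' with hY
  have hYdet : Y.det ≠ 0 := right_ne_zero_of_mul (right_ne_zero_of_mul hz)
  have hinj : Function.Injective (toLin' (pencil B A D U' C)) :=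
    mulVec_injective_of_det_ne_zero hdet
  have hmap : (homSpace B A).map (toLin' (pencil B A D U' C)) = LinearMap.range (toLin' D) := by
    refine Submodule.eq_of_le_of_finrank_eq (map_pencil_homSpace_le B A D U' C) ?_
    rw [← (Submodule.equivMapOfInjective _ hinj (homSpace B A)).finrank_eq, hr, hD]
  have hYmem : vec Y ∈ homSpace B A := by
    obtain ⟨x, hx, hxe⟩ : toLin' D e' ∈ (homSpace B A).map (toLin' (pencil B A D U' C)) :=
      hmap ▸ LinearMap.mem_range_self _ _
    rw [toLin'_apply, toLin'_apply] at hxe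
    rw [hY, vec_cramerSolution, ← hxe, mulVec_mulVec, adjugate_mul, smul_mulVec, one_mulVec]
    exact Submodule.smul_mem _ _ hx
  rw [vec_mem_homSpace] at hYmem
  refine ⟨GeneralLinearGroup.mkOfDetNeZero Y hYdet, fun i => ?_⟩
  have hS : B i * (GeneralLinearGroup.mkOfDetNeZero Y hYdet).val =
      (GeneralLinearGroup.mkOfDetNeZero Y hYdet).val * A i := hYmem i
  rw [← hS, Matrix.mul_assoc, ← Units.val_mul, mul_inv_cancel, Units.val_one, Matrix.mul_one]

/-- The test function with its arguments collected into three groups of variables. -/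
def flatTestFun {R : Type*} [CommRing R] (a : Fin p × Fin n × Fin n → R)
    (x : (Fin p × Fin n × Fin n) ⊕ ((Fin n × Fin n) × (Fin n × Fin n)) ⊕ Fin 2 → R)
    (z : (Fin p × (Fin n × Fin n) × (Fin n × Fin n)) ⊕ ((Fin n × Fin n) × (Fin n × Fin n)) ⊕
      (Fin n × Fin n) ⊕ Fin 2 → R) : R :=
  testFun (fun i => of fun r s => a (i, r, s)) (fun i => of fun r s => x (.inl (i, r, s)))
    (of fun r s => x (.inr (.inl (r, s)))) (fun i => x (.inr (.inr i)))
    (fun i => of fun r s => z (.inl (i, r, s))) (of fun r s => z (.inr (.inl (r, s))))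
    (fun i => z (.inr (.inr (.inl i)))) (fun i => z (.inr (.inr (.inr i))))

theorem flatTestFun_map {R R' : Type*} [CommRing R] [CommRing R'] (f : R →+* R')
    (a : Fin p × Fin n × Fin n → R) (x z) :
    f (flatTestFun a x z) = flatTestFun (f ∘ a) (f ∘ x) (f ∘ z) := by
  rw [flatTestFun, testFun_map]
  rfl

theorem eval_flatTestFun {σ : Type*} (v : σ → k) (a : Fin p × Fin n × Fin n → MvPolynomial σ k)
    (x z) : MvPolynomial.eval v (flatTestFun a x z) =
      flatTestFun (fun i => MvPolynomial.eval v (a i)) (fun i => MvPolynomial.eval v (x i))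
        (fun i => MvPolynomial.eval v (z i)) :=
  flatTestFun_map _ _ _ _

end Similarity

/-- **Theorem 1.** There are sizes `l_j, m_j` (`j ∈ [n²]`) and a map
`φ : (k^{n×n})^p → ∏_j k^{l_j×m_j}` with polynomial coordinate functions such that two
tuples `A, B` are simultaneously similar iff, for each `j`, `φ(B)_j` is obtained from
`φ(A)_j` by left multiplication by some invertible matrix; i.e. the preimage of an
orbit of `∏_j GL_{l_j}(k)` (acting by componentwise left multiplication) is empty or a
single orbit of `GL_n(k)` acting by simultaneous similarity. -/
theorem stmt11 (k : Type*) [Field k] (n p : ℕ) :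
    ∃ (l m : Fin (n ^ 2) → ℕ)
      (φ : (Fin p → Matrix (Fin n) (Fin n) k) →
        ∀ j : Fin (n ^ 2), Matrix (Fin (l j)) (Fin (m j)) k),
      (∀ (j : Fin (n ^ 2)) (a : Fin (l j)) (b : Fin (m j)),
        ∃ q : MvPolynomial (Fin p × Fin n × Fin n) k,
          ∀ A : Fin p → Matrix (Fin n) (Fin n) k,
            φ A j a b = MvPolynomial.eval (fun v => A v.1 v.2.1 v.2.2) q) ∧
      (∀ A B : Fin p → Matrix (Fin n) (Fin n) k,
        (∃ S : GL (Fin n) k, ∀ i, B i = S.val * A i * S⁻¹.val) ↔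
          ∀ j : Fin (n ^ 2), ∃ S : GL (Fin (l j)) k, φ B j = S.val * φ A j) := by
  let F := fun (A : Fin p → Matrix (Fin n) (Fin n) k) =>
    flatTestFun (fun v : Fin p × Fin n × Fin n => A v.1 v.2.1 v.2.2)
  let q₁ : MvPolynomial (((Fin p × Fin n × Fin n) ⊕ ((Fin n × Fin n) × (Fin n × Fin n)) ⊕ Fin 2) ⊕
      (Fin p × Fin n × Fin n) ⊕ ((Fin p × (Fin n × Fin n) × (Fin n × Fin n)) ⊕
        ((Fin n × Fin n) × (Fin n × Fin n)) ⊕ (Fin n × Fin n) ⊕ Fin 2)) k :=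
    flatTestFun (fun i => .X (.inr (.inl i))) (fun i => .X (.inl i)) (fun i => .X (.inr (.inr i)))
  let q₂ : MvPolynomial (((Fin p × (Fin n × Fin n) × (Fin n × Fin n)) ⊕
        ((Fin n × Fin n) × (Fin n × Fin n)) ⊕ (Fin n × Fin n) ⊕ Fin 2) ⊕
      (Fin p × Fin n × Fin n) ⊕
        ((Fin p × Fin n × Fin n) ⊕ ((Fin n × Fin n) × (Fin n × Fin n)) ⊕ Fin 2)) k :=
    flatTestFun (fun i => .X (.inr (.inl i))) (fun i => .X (.inr (.inr i))) (fun i => .X (.inl i))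
  have h₁ : ∀ A x z, F A x z =
      MvPolynomial.eval (Sum.elim x (Sum.elim (fun v => A v.1 v.2.1 v.2.2) z)) q₁ := by
    intro A x z
    simp [F, q₁, eval_flatTestFun]
  have h₂ : ∀ A x z, F A x z =
      MvPolynomial.eval (Sum.elim z (Sum.elim (fun v => A v.1 v.2.1 v.2.2) x)) q₂ := by
    intro A x z
    simp [F, q₂, eval_flatTestFun]
  obtain ⟨l, m, x, z, hφ₁, hφ₂⟩ := exists_sample_matrix F _ _
    (fun A x z => (h₁ A x z).trans (MvPolynomial.eval_sumElim_eq_dotProduct q₁ x _)) _ _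
    (fun A x z => (h₂ A x z).trans (MvPolynomial.eval_sumElim_eq_dotProduct q₂ z _))
  have hF : ∀ A B : Fin p → Matrix (Fin n) (Fin n) k, ∀ S : GL (Fin n) k,
      (∀ i, B i = S.val * A i * S⁻¹.val) → ∀ z, ∃ z', ∀ x, F B x z = F A x z' := by
    intro A B S hS z
    obtain ⟨U, C, t, ht⟩ := exists_testFun_eq (A := A) (B := B) S (fun i => by
      rw [hS i, Matrix.mul_assoc, ← Units.val_mul, inv_mul_cancel, Units.val_one, Matrix.mul_one])
      (fun i => of fun r s => z (.inl (i, r, s))) (of fun r s => z (.inr (.inl (r, s))))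
      (fun i => z (.inr (.inr (.inl i)))) (fun i => z (.inr (.inr (.inr i))))
    exact ⟨Sum.elim (fun v => U v.1 v.2.1 v.2.2) (Sum.elim (fun v => C v.1 v.2)
      (Sum.elim (fun i => z (.inr (.inr (.inl i)))) t)), fun x => ht _ _ _⟩
  refine ⟨fun _ => l, fun _ => m, fun A _ => of fun i j => F A (x j) (z i), fun _ i j => ?_,
    fun A B => ⟨?_, fun h => ?_⟩⟩
  · refine ⟨flatTestFun (fun v => .X v) (fun v => .C (x j v)) (fun v => .C (z i v)), fun A => ?_⟩
    simp [F, eval_flatTestFun]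
  · rintro ⟨S, hS⟩ _
    refine hφ₁ A B (hF A B S hS) (hF B A S⁻¹ fun i => ?_)
    rw [hS i, inv_inv, Matrix.mul_assoc, Matrix.mul_assoc, ← Units.val_mul, inv_mul_cancel,
      Units.val_one, Matrix.mul_one, ← Matrix.mul_assoc, ← Units.val_mul, inv_mul_cancel,
      Units.val_one, Matrix.one_mul]
  · obtain rfl | hn := Nat.eq_zero_or_pos n
    · exact ⟨1, fun i => Subsingleton.elim _ _⟩
    have key : ∀ A B, (∃ S : GL (Fin l) k, (of fun i j => F B (x j) (z i)) =
        S.val * of fun i j => F A (x j) (z i)) → ∀ X D t,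
        (∃ U C e z, testFun B X D t U C e z ≠ 0) → ∃ U C e z, testFun A X D t U C e z ≠ 0 := by
      rintro A B hS X D t ⟨U, C, e, s, hs⟩
      obtain ⟨z', hz'⟩ := hφ₂ A B hS
        (Sum.elim (fun v => X v.1 v.2.1 v.2.2) (Sum.elim (fun v => D v.1 v.2) t))
        ⟨Sum.elim (fun v => U v.1 v.2.1 v.2.2) (Sum.elim (fun v => C v.1 v.2) (Sum.elim e s)), hs⟩
      exact ⟨_, _, _, _, hz'⟩
    obtain ⟨S, hS⟩ := h ⟨0, pow_pos hn 2⟩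
    refine exists_conj_of_testFun fun X D t => ⟨key B A ⟨S⁻¹, ?_⟩ X D t, key A B ⟨S, hS⟩ X D t⟩
    beta_reduce at S hS
    rw [hS, ← Matrix.mul_assoc, ← Units.val_mul, inv_mul_cancel, Units.val_one, Matrix.one_mul]
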